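/- Proof-completeness of the Consecution Calculus CC: every valid consecution α ⇒ δ (i.e. one verified by every interpretation) has a proof in CC, i.e. is deducible in CC from the consecution ⊤ = (∅ ⇒ ∅). -/

import Mathlib

/-- Formulas of classical propositional logic: propositional variables,
negation, conjunction, disjunction. -/
inductive Fml : Type
  | var : ℕ → Fml
  | neg : Fml → Fml
  | conj : Fml → Fml → Fml
  | disj : Fml → Fml → Fml
  deriving DecidableEq

/-- A datum: a finite set of finite sets (components) of formulas. -/
abbrev Datum := Finset (Finset Fml)

/-- Truth-value of a formula under an interpretation of the variables. -/
def Fml.eval (v : ℕ → Bool) : Fml → Bool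
  | .var n => v n
  | .neg A => !A.eval v
  | .conj A B => A.eval v && B.eval v
  | .disj A B => A.eval v || B.eval v

/-- An interpretation verifies a datum iff some component has all its
formulas true. -/
def Verifies (v : ℕ → Bool) (α : Datum) : Prop :=
  ∃ Γ ∈ α, ∀ A ∈ Γ, A.eval v = true

/-- The analytic G-rules of the Data Calculus DC. -/
inductive GStep : Datum → Datum → Prop
  | conj (Γ : Finset Fml) (A B : Fml) (ρ : Datum) :
      GStep (insert (insert (Fml.conj A B) Γ) ρ)
            (insert (insert A (insert B Γ)) ρ)
  | disj (Γ : Finset Fml) (A B : Fml) (ρ : Datum) :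
      GStep (insert (insert (Fml.disj A B) Γ) ρ)
            (insert (insert A Γ) (insert (insert B Γ) ρ))
  | negneg (Γ : Finset Fml) (A : Fml) (ρ : Datum) :
      GStep (insert (insert (Fml.neg (Fml.neg A)) Γ) ρ)
            (insert (insert A Γ) ρ)
  | negdisj (Γ : Finset Fml) (A B : Fml) (ρ : Datum) :
      GStep (insert (insert (Fml.neg (Fml.disj A B)) Γ) ρ)
            (insert (insert (Fml.neg A) (insert (Fml.neg B) Γ)) ρ)
  | negconj (Γ : Finset Fml) (A B : Fml) (ρ : Datum) :
      GStep (insert (insert (Fml.neg (Fml.conj A B)) Γ) ρ)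
            (insert (insert (Fml.neg A) Γ) (insert (insert (Fml.neg B) Γ) ρ))

/-- The analytic N-rule NC: delete a component containing a pair A, ¬A. -/
def NCStep (α β : Datum) : Prop :=
  ∃ (Γ : Finset Fml) (A : Fml),
    α = insert (insert A (insert (Fml.neg A) Γ)) β

/-- The synthetic N-rule EM: replace a component Γ by the two components
Γ∪{A} and Γ∪{¬A}. -/
def EMStep (α β : Datum) : Prop :=
  ∃ (Γ : Finset Fml) (A : Fml) (ρ : Datum),
    α = insert Γ ρ ∧
    β = insert (insert A Γ) (insert (insert (Fml.neg A) Γ) ρ)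

/-- The analytic S-rule Del: replace a component Γ∪Δ by its subset Γ. -/
def DelStep (α β : Datum) : Prop :=
  ∃ (Γ Δ : Finset Fml) (ρ : Datum),
    α = insert (Γ ∪ Δ) ρ ∧ β = insert Γ ρ

/-- The synthetic S-rule Exp: add an arbitrary new component. -/
def ExpStep (α β : Datum) : Prop :=
  ∃ Γ : Finset Fml, β = insert Γ α

/-- A dual datum: again a finite set of finite sets (components) of formulas. -/
abbrev DualDatum := Finset (Finset Fml)

/-- An interpretation verifies a dual datum iff every component contains at
least one true formula. -/
def DVerifies (v : ℕ → Bool) (δ : DualDatum) : Prop :=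
  ∀ Γ ∈ δ, ∃ A ∈ Γ, A.eval v = true

/-- The analytic G-rules of the Dual Data Calculus DDC. -/
inductive DualGStep : DualDatum → DualDatum → Prop
  | disj (Γ : Finset Fml) (A B : Fml) (ρ : DualDatum) :
      DualGStep (insert (insert (Fml.disj A B) Γ) ρ)
                (insert (insert A (insert B Γ)) ρ)
  | conj (Γ : Finset Fml) (A B : Fml) (ρ : DualDatum) :
      DualGStep (insert (insert (Fml.conj A B) Γ) ρ)
                (insert (insert A Γ) (insert (insert B Γ) ρ))
  | negneg (Γ : Finset Fml) (A : Fml) (ρ : DualDatum) :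
      DualGStep (insert (insert (Fml.neg (Fml.neg A)) Γ) ρ)
                (insert (insert A Γ) ρ)
  | negconj (Γ : Finset Fml) (A B : Fml) (ρ : DualDatum) :
      DualGStep (insert (insert (Fml.neg (Fml.conj A B)) Γ) ρ)
                (insert (insert (Fml.neg A) (insert (Fml.neg B) Γ)) ρ)
  | negdisj (Γ : Finset Fml) (A B : Fml) (ρ : DualDatum) :
      DualGStep (insert (insert (Fml.neg (Fml.disj A B)) Γ) ρ)
                (insert (insert (Fml.neg A) Γ) (insert (insert (Fml.neg B) Γ) ρ))

/-- The synthetic N-rule EM of DDC: add a component containing a pair A, ¬A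
(possibly together with further formulas). -/
def DualEMStep (α β : DualDatum) : Prop :=
  ∃ (Γ : Finset Fml) (A : Fml),
    β = insert (insert A (insert (Fml.neg A) Γ)) α

/-- The analytic N-rule NC of DDC: replace the components Γ∪{A}, Γ∪{¬A}
by the component Γ. -/
def DualNCStep (α β : DualDatum) : Prop :=
  ∃ (Γ : Finset Fml) (A : Fml) (ρ : DualDatum),
    α = insert (insert A Γ) (insert (insert (Fml.neg A) Γ) ρ) ∧
    β = insert Γ ρ

/-- The synthetic S-rule Exp of DDC: replace a component Γ by a superset Γ∪Δ. -/
def DualExpStep (α β : DualDatum) : Prop :=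
  ∃ (Γ Δ : Finset Fml) (ρ : DualDatum),
    α = insert Γ ρ ∧ β = insert (Γ ∪ Δ) ρ

/-- The analytic S-rule Del of DDC: delete a component. -/
def DualDelStep (α β : DualDatum) : Prop :=
  ∃ Γ : Finset Fml, α = insert Γ β

/-- A consecution: a pair of a datum and a dual datum. -/
abbrev Consec := Datum × DualDatum

/-- Criss-crossing of a datum with a dual datum: every component of the
datum shares a formula with every component of the dual datum. -/
def CrissCross (β : Datum) (δ : DualDatum) : Prop :=
  ∀ Γ ∈ β, ∀ Δ ∈ δ, ∃ A, A ∈ Γ ∧ A ∈ Δ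

/-- The rules of the Consecution Calculus CC. -/
inductive CCStep : Consec → Consec → Prop
  | gLeft {α' α : Datum} {δ : DualDatum} :
      GStep α α' → CCStep (α', δ) (α, δ)
  | gRight {α : Datum} {δ' δ : DualDatum} :
      DualGStep δ δ' → CCStep (α, δ') (α, δ)
  | nc (α : Datum) (δ : DualDatum) (Γ : Finset Fml) (A : Fml) :
      CCStep (α, δ) (insert (insert A (insert (Fml.neg A) Γ)) α, δ)
  | em (α : Datum) (δ : DualDatum) (Γ : Finset Fml) (A : Fml) :
      CCStep (α, δ) (α, insert (insert A (insert (Fml.neg A) Γ)) δ)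
  | crL {α : Datum} {δ : DualDatum} (β : Datum) :
      CrissCross β δ → CCStep (α, δ) (α ∪ β, δ)
  | crR {α : Datum} {δ : DualDatum} (ε : DualDatum) :
      CrissCross α ε → CCStep (α, δ) (α, δ ∪ ε)

/-- An interpretation verifies a consecution α ⇒ δ iff it verifies δ
whenever it verifies α; the consecution is valid iff every interpretation
verifies it. -/
def ValidConsec (c : Consec) : Prop :=
  ∀ v : ℕ → Bool, Verifies v c.1 → DVerifies v c.2

def Fml.wt : Fml → ℕ
  | .var _ => 1
  | .neg A => A.wt + 1
  | .conj A B => A.wt + B.wt + 2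
  | .disj A B => A.wt + B.wt + 2

def cwt (Γ : Finset Fml) : ℕ := ∑ A ∈ Γ, A.wt

def dwt (α : Finset (Finset Fml)) : ℕ := ∑ Γ ∈ α, 3 ^ cwt Γ

def IsLit (A : Fml) : Prop := ∃ n, A = Fml.var n ∨ A = Fml.neg (Fml.var n)

lemma cwt_insert_le (A : Fml) (Γ : Finset Fml) : cwt (insert A Γ) ≤ A.wt + cwt Γ := by
  unfold cwt
  by_cases h : A ∈ Γ
  · simp [h]
  · rw [Finset.sum_insert h]

lemma dwt_insert_le (A : Finset Fml) (Γ : Finset (Finset Fml)) :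
    dwt (insert A Γ) ≤ 3 ^ cwt A + dwt Γ := by
  unfold dwt
  by_cases h : A ∈ Γ
  · simp [h]
  · rw [Finset.sum_insert h]

lemma dwt_one {X Y : Finset Fml} {ρ : Finset (Finset Fml)} (hX : X ∉ ρ) (h : cwt Y < cwt X) :
    dwt (insert Y ρ) < dwt (insert X ρ) := by
  have h1 := dwt_insert_le Y ρ
  have h2 : dwt (insert X ρ) = 3 ^ cwt X + dwt ρ := by
    unfold dwt; rw [Finset.sum_insert hX]
  have h3 : 3 ^ cwt Y < 3 ^ cwt X := Nat.pow_lt_pow_right (by norm_num) h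
  omega

lemma dwt_two {X Y Z : Finset Fml} {ρ : Finset (Finset Fml)} (hX : X ∉ ρ) (h : cwt Y < cwt X)
    (h' : cwt Z < cwt X) :
    dwt (insert Y (insert Z ρ)) < dwt (insert X ρ) := by
  have h1 := dwt_insert_le Y (insert Z ρ)
  have h1' := dwt_insert_le Z ρ
  have h2 : dwt (insert X ρ) = 3 ^ cwt X + dwt ρ := by
    unfold dwt; rw [Finset.sum_insert hX]
  have h3 : 3 ^ (cwt Y + 1) ≤ 3 ^ cwt X := Nat.pow_le_pow_right (by norm_num) h
  have h4 : 3 ^ (cwt Z + 1) ≤ 3 ^ cwt X := Nat.pow_le_pow_right (by norm_num) h'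
  have h5 : 0 < 3 ^ cwt X := by positivity
  rw [pow_succ] at h3 h4
  omega

lemma decomp {α : Finset (Finset Fml)} {G : Finset Fml} {F : Fml} (hG : G ∈ α) (hF : F ∈ G) :
    ∃ Γ ρ, F ∉ Γ ∧ insert F Γ ∉ ρ ∧ α = insert (insert F Γ) ρ := by
  refine ⟨G.erase F, α.erase G, by simp, ?_, ?_⟩
  · simp [Finset.insert_erase hF]
  · rw [Finset.insert_erase hF, Finset.insert_erase hG]

lemma cwt_ins {F : Fml} {Γ : Finset Fml} (h : F ∉ Γ) : cwt (insert F Γ) = F.wt + cwt Γ := by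
  unfold cwt; rw [Finset.sum_insert h]

lemma cwt_lt1 {F A : Fml} {Γ : Finset Fml} (h : F ∉ Γ) (hw : A.wt < F.wt) :
    cwt (insert A Γ) < cwt (insert F Γ) := by
  have := cwt_insert_le A Γ
  rw [cwt_ins h]; omega

lemma cwt_lt2 {F A B : Fml} {Γ : Finset Fml} (h : F ∉ Γ) (hw : A.wt + B.wt < F.wt) :
    cwt (insert A (insert B Γ)) < cwt (insert F Γ) := by
  have := cwt_insert_le A (insert B Γ)
  have := cwt_insert_le B Γ
  rw [cwt_ins h]; omega

lemma redL {α : Datum} {G : Finset Fml} {F : Fml} (hG : G ∈ α) (hF : F ∈ G) (hl : ¬ IsLit F) :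
    ∃ α', GStep α α' ∧ dwt α' < dwt α ∧ ∀ v, Verifies v α' → Verifies v α := by
  obtain ⟨Γ, ρ, h1, h2, rfl⟩ := decomp hG hF
  rcases F with n | (n | A | ⟨A, B⟩ | ⟨A, B⟩) | ⟨A, B⟩ | ⟨A, B⟩
  · exact absurd ⟨n, Or.inl rfl⟩ hl
  · exact absurd ⟨n, Or.inr rfl⟩ hl
  · refine ⟨_, GStep.negneg Γ A ρ, dwt_one h2 (cwt_lt1 h1 (by simp [Fml.wt]; try omega)), fun v => ?_⟩
    simp [Verifies, Fml.eval]
  · refine ⟨_, GStep.negconj Γ A B ρ, dwt_two h2 (cwt_lt1 h1 (by simp [Fml.wt]; try omega))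
      (cwt_lt1 h1 (by simp [Fml.wt]; try omega)), fun v => ?_⟩
    simp only [Verifies, Fml.eval, Finset.exists_mem_insert, Finset.forall_mem_insert]
    cases A.eval v <;> cases B.eval v <;> simp <;> tauto
  · refine ⟨_, GStep.negdisj Γ A B ρ, dwt_one h2 (cwt_lt2 h1 (by simp [Fml.wt]; try omega)), fun v => ?_⟩
    simp only [Verifies, Fml.eval, Finset.exists_mem_insert, Finset.forall_mem_insert]
    cases A.eval v <;> cases B.eval v <;> simp <;> tauto
  · refine ⟨_, GStep.conj Γ A B ρ, dwt_one h2 (cwt_lt2 h1 (by simp [Fml.wt]; try omega)), fun v => ?_⟩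
    simp only [Verifies, Fml.eval, Finset.exists_mem_insert, Finset.forall_mem_insert]
    cases A.eval v <;> cases B.eval v <;> simp <;> tauto
  · refine ⟨_, GStep.disj Γ A B ρ, dwt_two h2 (cwt_lt1 h1 (by simp [Fml.wt]; try omega))
      (cwt_lt1 h1 (by simp [Fml.wt]; try omega)), fun v => ?_⟩
    simp only [Verifies, Fml.eval, Finset.exists_mem_insert, Finset.forall_mem_insert]
    cases A.eval v <;> cases B.eval v <;> simp <;> tauto

lemma redR {α : DualDatum} {G : Finset Fml} {F : Fml} (hG : G ∈ α) (hF : F ∈ G)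
    (hl : ¬ IsLit F) :
    ∃ α', DualGStep α α' ∧ dwt α' < dwt α ∧ ∀ v, DVerifies v α → DVerifies v α' := by
  obtain ⟨Γ, ρ, h1, h2, rfl⟩ := decomp hG hF
  rcases F with n | (n | A | ⟨A, B⟩ | ⟨A, B⟩) | ⟨A, B⟩ | ⟨A, B⟩
  · exact absurd ⟨n, Or.inl rfl⟩ hl
  · exact absurd ⟨n, Or.inr rfl⟩ hl
  · refine ⟨_, DualGStep.negneg Γ A ρ, dwt_one h2 (cwt_lt1 h1 (by simp [Fml.wt]; try omega)),
      fun v => ?_⟩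
    simp [DVerifies, Fml.eval]
  · refine ⟨_, DualGStep.negconj Γ A B ρ, dwt_one h2 (cwt_lt2 h1 (by simp [Fml.wt]; try omega)),
      fun v => ?_⟩
    simp only [DVerifies, Fml.eval, Finset.exists_mem_insert, Finset.forall_mem_insert]
    cases A.eval v <;> cases B.eval v <;> simp <;> tauto
  · refine ⟨_, DualGStep.negdisj Γ A B ρ, dwt_two h2 (cwt_lt1 h1 (by simp [Fml.wt]; try omega))
      (cwt_lt1 h1 (by simp [Fml.wt]; try omega)), fun v => ?_⟩
    simp only [DVerifies, Fml.eval, Finset.exists_mem_insert, Finset.forall_mem_insert]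
    cases A.eval v <;> cases B.eval v <;> simp <;> tauto
  · refine ⟨_, DualGStep.conj Γ A B ρ, dwt_two h2 (cwt_lt1 h1 (by simp [Fml.wt]; try omega))
      (cwt_lt1 h1 (by simp [Fml.wt]; try omega)), fun v => ?_⟩
    simp only [DVerifies, Fml.eval, Finset.exists_mem_insert, Finset.forall_mem_insert]
    cases A.eval v <;> cases B.eval v <;> simp <;> tauto
  · refine ⟨_, DualGStep.disj Γ A B ρ, dwt_one h2 (cwt_lt2 h1 (by simp [Fml.wt]; try omega)),
      fun v => ?_⟩
    simp only [DVerifies, Fml.eval, Finset.exists_mem_insert, Finset.forall_mem_insert]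
    cases A.eval v <;> cases B.eval v <;> simp <;> tauto

def Clash (Γ : Finset Fml) : Prop := ∃ A, A ∈ Γ ∧ Fml.neg A ∈ Γ

lemma clash_eq {Γ : Finset Fml} (h : Clash Γ) : ∃ A, insert A (insert (Fml.neg A) Γ) = Γ := by
  obtain ⟨A, h1, h2⟩ := h
  exact ⟨A, by rw [Finset.insert_eq_of_mem h2, Finset.insert_eq_of_mem h1]⟩

lemma addL (α δ S : Finset (Finset Fml)) (hS : ∀ Γ ∈ S, Clash Γ) :
    Relation.ReflTransGen CCStep (α, δ) (S ∪ α, δ) := by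
  induction S using Finset.induction_on with
  | empty => simpa using Relation.ReflTransGen.refl
  | insert Γ S _ ih =>
    refine (ih fun X hX => hS X (Finset.mem_insert_of_mem hX)).tail ?_
    obtain ⟨A, hA⟩ := clash_eq (hS Γ (Finset.mem_insert_self _ _))
    have := CCStep.nc (S ∪ α) δ Γ A
    rwa [hA, ← Finset.insert_union] at this

lemma addR (α δ S : Finset (Finset Fml)) (hS : ∀ Γ ∈ S, Clash Γ) :
    Relation.ReflTransGen CCStep (α, δ) (α, S ∪ δ) := by
  induction S using Finset.induction_on with
  | empty => simpa using Relation.ReflTransGen.refl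
  | insert Γ S _ ih =>
    refine (ih fun X hX => hS X (Finset.mem_insert_of_mem hX)).tail ?_
    obtain ⟨A, hA⟩ := clash_eq (hS Γ (Finset.mem_insert_self _ _))
    have := CCStep.em α (S ∪ δ) Γ A
    rwa [hA, ← Finset.insert_union] at this

open Classical in
lemma share {α δ : Finset (Finset Fml)} (h : ValidConsec (α, δ))
    (hα : ∀ Γ ∈ α, ∀ F ∈ Γ, IsLit F) (hδ : ∀ Γ ∈ δ, ∀ F ∈ Γ, IsLit F)
    {Γ Δ : Finset Fml} (hΓ : Γ ∈ α) (hΔ : Δ ∈ δ) (cΓ : ¬ Clash Γ) (cΔ : ¬ Clash Δ) :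
    ∃ A, A ∈ Γ ∧ A ∈ Δ := by
  by_contra hn
  push Not at hn
  let v : ℕ → Bool := fun n =>
    decide (Fml.var n ∈ Γ ∨ (Fml.neg (Fml.var n) ∉ Γ ∧ Fml.var n ∉ Δ))
  have h1 : Verifies v α := by
    refine ⟨Γ, hΓ, fun A hA => ?_⟩
    obtain ⟨n, rfl | rfl⟩ := hα Γ hΓ A hA
    · simp [Fml.eval, v, hA]
    · have : Fml.var n ∉ Γ := fun hc => cΓ ⟨_, hc, hA⟩
      simp [Fml.eval, v, hA, this]
  obtain ⟨A, hA, hv⟩ := h v h1 Δ hΔ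
  obtain ⟨n, rfl | rfl⟩ := hδ Δ hΔ A hA
  · have : Fml.var n ∉ Γ := fun hc => hn _ hc hA
    simp [Fml.eval, v, hA, this] at hv
  · have h2 : Fml.neg (Fml.var n) ∉ Γ := fun hc => hn _ hc hA
    have h3 : Fml.var n ∉ Δ := fun hc => cΔ ⟨_, hc, hA⟩
    simp [Fml.eval, v, h2, h3] at hv

open Classical in
lemma litCase {α δ : Finset (Finset Fml)} (h : ValidConsec (α, δ))
    (hα : ∀ Γ ∈ α, ∀ F ∈ Γ, IsLit F) (hδ : ∀ Γ ∈ δ, ∀ F ∈ Γ, IsLit F) :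
    Relation.ReflTransGen CCStep ((∅ : Datum), (∅ : DualDatum)) (α, δ) := by
  have s1 : CCStep (∅, ∅) (∅ ∪ α.filter (fun Γ => ¬ Clash Γ), ∅) :=
    CCStep.crL _ (by intro _ _ _ h; simp at h)
  rw [Finset.empty_union] at s1
  have s2 : CCStep (α.filter (fun Γ => ¬ Clash Γ), ∅)
      (α.filter (fun Γ => ¬ Clash Γ), ∅ ∪ δ.filter (fun Γ => ¬ Clash Γ)) := by
    refine CCStep.crR _ ?_
    intro Γ hΓ Δ hΔ
    rw [Finset.mem_filter] at hΓ hΔ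
    exact share h hα hδ hΓ.1 hΔ.1 hΓ.2 hΔ.2
  rw [Finset.empty_union] at s2
  have s3 := addL (α.filter (fun Γ => ¬ Clash Γ)) (δ.filter (fun Γ => ¬ Clash Γ))
    (α.filter Clash) (by simp)
  have s4 := addR α (δ.filter (fun Γ => ¬ Clash Γ)) (δ.filter Clash) (by simp)
  have e1 : α.filter Clash ∪ α.filter (fun Γ => ¬ Clash Γ) = α := by
    ext; simp only [Finset.mem_union, Finset.mem_filter]; tauto
  have e2 : δ.filter Clash ∪ δ.filter (fun Γ => ¬ Clash Γ) = δ := by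
    ext; simp only [Finset.mem_union, Finset.mem_filter]; tauto
  rw [e1] at s3
  rw [e2] at s4
  exact (((Relation.ReflTransGen.single s1).tail s2).trans s3).trans s4

lemma cc_aux (n : ℕ) : ∀ α δ : Finset (Finset Fml), dwt α + dwt δ = n → ValidConsec (α, δ) →
    Relation.ReflTransGen CCStep ((∅ : Datum), (∅ : DualDatum)) (α, δ) := by
  induction n using Nat.strong_induction_on with
  | _ n ih =>
  intro α δ hn h
  by_cases hα : ∀ Γ ∈ α, ∀ F ∈ Γ, IsLit F
  · by_cases hδ : ∀ Γ ∈ δ, ∀ F ∈ Γ, IsLit F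
    · exact litCase h hα hδ
    · push Not at hδ
      obtain ⟨Γ, hΓ, F, hF, hl⟩ := hδ
      obtain ⟨δ', g, lt, hv⟩ := redR hΓ hF hl
      exact (ih _ (by omega) α δ' rfl fun v h1 => hv v (h v h1)).tail (CCStep.gRight g)
  · push Not at hα
    obtain ⟨Γ, hΓ, F, hF, hl⟩ := hα
    obtain ⟨α', g, lt, hv⟩ := redL hΓ hF hl
    exact (ih _ (by omega) α' δ rfl fun v h1 => h v (hv v h1)).tail (CCStep.gLeft g)

/-- Proof-completeness of CC: every valid consecution is deducible in CC
from the consecution ⊤ = (∅ ⇒ ∅). -/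
theorem cc_proof_completeness (α : Datum) (δ : DualDatum)
    (h : ValidConsec (α, δ)) :
    Relation.ReflTransGen CCStep ((∅ : Datum), (∅ : DualDatum)) (α, δ) := by
  exact cc_aux _ α δ rfl h
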